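/- Let κ be a perfect kernel on X satisfying Frostman's maximum principle and the domination principle, let A ⊆ X satisfy cap_*(A) > 0 and E⁺(A) closed in (E⁺, d), let f := −U^ζ where ζ ∈ E⁺ and ζ(X) ≤ 1, and assume either cap_*(A) < ∞ or ζ^A(X) = 1, so that the solution λ_{A,f} exists. Set η_{A,f} := (1 − ζ^A(X))/cap_*(A) (so η_{A,f} = 0 when cap_*(A) = ∞) and Λ_{A,f} := { μ ∈ E⁺ : U_f^μ ≥ η_{A,f} n.e. on A }. Then λ_{A,f} ∈ Λ_{A,f} and λ_{A,f} is the unique measure of minimum energy in Λ_{A,f}: I(λ_{A,f}) ≤ I(μ) for all μ ∈ Λ_{A,f}, with equality only for μ = λ_{A,f}. -/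

import Mathlib

open MeasureTheory Topology Filter Set ENNReal

noncomputable section

namespace GaussVar

variable {X : Type*} [TopologicalSpace X] [MeasurableSpace X]

/-- A (positive) Radon measure: a regular Borel measure. -/
def IsRadon (μ : Measure X) : Prop := μ.Regular

/-- The mutual energy `I(μ,ν) = ∬ κ(x,y) d(μ⊗ν)(x,y)`. -/
def mutualEnergy (κ : X → X → ℝ≥0∞) (μ ν : Measure X) : ℝ≥0∞ :=
  ∫⁻ p : X × X, κ p.1 p.2 ∂(μ.prod ν)

/-- The energy `I(μ) := I(μ,μ)`. -/
def energy (κ : X → X → ℝ≥0∞) (μ : Measure X) : ℝ≥0∞ := mutualEnergy κ μ μ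

/-- Membership in the cone `E⁺` of Radon measures with finite energy. -/
def memEplus (κ : X → X → ℝ≥0∞) (μ : Measure X) : Prop :=
  IsRadon μ ∧ energy κ μ < ⊤

/-- A kernel: symmetric and lower semicontinuous with values in `[0,∞]`. -/
def IsKernel (κ : X → X → ℝ≥0∞) : Prop :=
  (∀ x y, κ x y = κ y x) ∧ LowerSemicontinuous (fun p : X × X => κ p.1 p.2)

/-- The strong (energy) metric `d(μ,ν) := (I(μ)+I(ν)−2I(μ,ν))^{1/2}` on `E⁺`. -/
def strongDist (κ : X → X → ℝ≥0∞) (μ ν : Measure X) : ℝ :=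
  Real.sqrt ((energy κ μ).toReal + (energy κ ν).toReal - 2 * (mutualEnergy κ μ ν).toReal)

/-- The energy principle (strict positive definiteness). -/
def EnergyPrinciple (κ : X → X → ℝ≥0∞) : Prop :=
  ∀ μ ν : Measure X, memEplus κ μ → memEplus κ ν →
    2 * mutualEnergy κ μ ν ≤ energy κ μ + energy κ ν ∧
      (2 * mutualEnergy κ μ ν = energy κ μ + energy κ ν → μ = ν)

/-- Convergence of a sequence in the strong metric. -/
def StrongTendstoSeq (κ : X → X → ℝ≥0∞) (μ : ℕ → Measure X) (μ₀ : Measure X) : Prop :=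
  Tendsto (fun n => strongDist κ (μ n) μ₀) atTop (𝓝 0)

/-- Vague convergence of a sequence of measures. -/
def VagueTendstoSeq (μ : ℕ → Measure X) (μ₀ : Measure X) : Prop :=
  ∀ φ : X → ℝ, Continuous φ → HasCompactSupport φ →
    Tendsto (fun n => ∫ x, φ x ∂(μ n)) atTop (𝓝 (∫ x, φ x ∂μ₀))

/-- Cauchy sequence in the strong metric. -/
def StrongCauchySeq (κ : X → X → ℝ≥0∞) (μ : ℕ → Measure X) : Prop :=
  ∀ ε : ℝ, 0 < ε → ∃ N : ℕ, ∀ m ≥ N, ∀ n ≥ N, strongDist κ (μ m) (μ n) < ε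

/-- A perfect kernel: satisfies the energy principle, `(E⁺,d)` is complete, and
strong convergence implies vague convergence. -/
def IsPerfect (κ : X → X → ℝ≥0∞) : Prop :=
  EnergyPrinciple κ ∧
    (∀ μ : ℕ → Measure X, (∀ n, memEplus κ (μ n)) → StrongCauchySeq κ μ →
        ∃ μ₀ : Measure X, memEplus κ μ₀ ∧ StrongTendstoSeq κ μ μ₀) ∧
    (∀ (μ : ℕ → Measure X) (μ₀ : Measure X), (∀ n, memEplus κ (μ n)) → memEplus κ μ₀ →
        StrongTendstoSeq κ μ μ₀ → VagueTendstoSeq μ μ₀)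

/-- `μ` is concentrated on `A`: the complement of `A` is locally `μ`-negligible. -/
def Concentrated (μ : Measure X) (A : Set X) : Prop :=
  ∀ K : Set X, IsCompact K → μ (Aᶜ ∩ K) = 0

/-- Membership in `Ĕ⁺(A)`: finite-energy Radon measures concentrated on `A`
of unit total mass. -/
def memBreve (κ : X → X → ℝ≥0∞) (A : Set X) (μ : Measure X) : Prop :=
  memEplus κ μ ∧ Concentrated μ A ∧ μ Set.univ = 1

/-- `w(A) := inf { I(μ) : μ ∈ Ĕ⁺(A) }` (with `inf ∅ = ⊤`). -/
def wcap (κ : X → X → ℝ≥0∞) (A : Set X) : ℝ≥0∞ :=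
  ⨅ (μ : Measure X) (_ : memBreve κ A μ), energy κ μ

/-- The inner capacity `cap_*(A) := 1 / w(A)`. -/
def innerCap (κ : X → X → ℝ≥0∞) (A : Set X) : ℝ≥0∞ := (wcap κ A)⁻¹

/-- The outer capacity `cap^*(E) := inf { cap_*(D) : D open, E ⊆ D }`. -/
def outerCap (κ : X → X → ℝ≥0∞) (E : Set X) : ℝ≥0∞ :=
  ⨅ (D : Set X) (_ : IsOpen D ∧ E ⊆ D), innerCap κ D

/-- `P` holds nearly everywhere (n.e.) on `A`: the exceptional subset of `A`
has inner capacity zero. -/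
def NearlyEverywhere (κ : X → X → ℝ≥0∞) (A : Set X) (P : X → Prop) : Prop :=
  innerCap κ {x ∈ A | ¬ P x} = 0

/-- The potential `U^μ(x) := ∫ κ(x,y) dμ(y)`. -/
def potential (κ : X → X → ℝ≥0∞) (μ : Measure X) (x : X) : ℝ≥0∞ :=
  ∫⁻ y, κ x y ∂μ

/-- An external field: `f = ψ + U^{ϑ⁺} − U^{ϑ⁻}` where `ψ` is lower semicontinuous,
`(−∞,∞]`-valued, positive if `X` is noncompact, and `ϑ⁺, ϑ⁻ ∈ E⁺`. -/
def IsExternalField (κ : X → X → ℝ≥0∞) (f : X → EReal) : Prop :=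
  ∃ (ψ : X → EReal) (ϑp ϑm : Measure X),
    LowerSemicontinuous ψ ∧ (∀ x, ψ x ≠ ⊥) ∧ (¬ CompactSpace X → ∀ x, 0 ≤ ψ x) ∧
    memEplus κ ϑp ∧ memEplus κ ϑm ∧
    ∀ x, f x = ψ x + (potential κ ϑp x : EReal) - (potential κ ϑm x : EReal)

/-- `f` is `μ`-integrable (as an extended-real-valued function). -/
def FieldIntegrable (f : X → EReal) (μ : Measure X) : Prop :=
  Integrable (fun x => (f x).toReal) μ ∧ (∀ᵐ x ∂μ, f x ≠ ⊤ ∧ f x ≠ ⊥)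

/-- `∫ f dμ` for an a.e.-finite integrable field. -/
def fieldIntegral (f : X → EReal) (μ : Measure X) : ℝ := ∫ x, (f x).toReal ∂μ

/-- The Gauss functional `I_f(μ) := I(μ) + 2 ∫ f dμ`. -/
def gaussI (κ : X → X → ℝ≥0∞) (f : X → EReal) (μ : Measure X) : ℝ :=
  (energy κ μ).toReal + 2 * fieldIntegral f μ

/-- Membership in `Ĕ⁺_f(A)`. -/
def Admissible (κ : X → X → ℝ≥0∞) (A : Set X) (f : X → EReal) (μ : Measure X) : Prop :=
  memBreve κ A μ ∧ FieldIntegrable f μ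

/-- `w_f(A) := inf { I_f(μ) : μ ∈ Ĕ⁺_f(A) }` (with `inf ∅ = ⊤`). -/
def wf (κ : X → X → ℝ≥0∞) (A : Set X) (f : X → EReal) : EReal :=
  ⨅ (μ : Measure X) (_ : Admissible κ A f μ), ((gaussI κ f μ : ℝ) : EReal)

/-- `l` is a solution of the inner Gauss variational problem for `(A,f)`. -/
def IsSolution (κ : X → X → ℝ≥0∞) (A : Set X) (f : X → EReal) (l : Measure X) : Prop :=
  Admissible κ A f l ∧ ((gaussI κ f l : ℝ) : EReal) = wf κ A f

/-- The `f`-weighted potential `U_f^μ := U^μ + f`. -/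
def wPotential (κ : X → X → ℝ≥0∞) (f : X → EReal) (μ : Measure X) (x : X) : EReal :=
  (potential κ μ x : EReal) + f x

/-- `∫ U_f^μ dμ`, the weighted equilibrium constant of a solution. -/
def wConst (κ : X → X → ℝ≥0∞) (f : X → EReal) (μ : Measure X) : ℝ :=
  ∫ x, (wPotential κ f μ x).toReal ∂μ

/-- The cone `E⁺(A)` is closed in the strong metric. -/
def StrongClosedEplusOn (κ : X → X → ℝ≥0∞) (A : Set X) : Prop :=
  ∀ (μ : ℕ → Measure X) (μ₀ : Measure X),
    (∀ n, memEplus κ (μ n) ∧ Concentrated (μ n) A) →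
    memEplus κ μ₀ → StrongTendstoSeq κ μ μ₀ → Concentrated μ₀ A

/-- Frostman's (first) maximum principle. -/
def FrostmanMax (κ : X → X → ℝ≥0∞) : Prop :=
  ∀ μ : Measure X, memEplus κ μ →
    (∀ x : X, (∀ U : Set X, IsOpen U → x ∈ U → 0 < μ U) → potential κ μ x ≤ 1) →
    ∀ x : X, potential κ μ x ≤ 1

/-- The domination (second maximum) principle. -/
def DominationPrinciple (κ : X → X → ℝ≥0∞) : Prop :=
  ∀ μ ν : Measure X, memEplus κ μ → memEplus κ ν →
    (∀ᵐ x ∂μ, potential κ μ x ≤ potential κ ν x) →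
    ∀ x : X, potential κ μ x ≤ potential κ ν x

/-- `β` is the inner balayage of `ζ` onto `A`: `β ∈ E⁺(A)` and `U^β = U^ζ` n.e. on `A`. -/
def IsInnerBalayage (κ : X → X → ℝ≥0∞) (A : Set X) (ζ β : Measure X) : Prop :=
  memEplus κ β ∧ Concentrated β A ∧
    NearlyEverywhere κ A (fun x => potential κ β x = potential κ ζ x)

/-- `γ` is the inner capacitary measure of `A`: `γ ∈ E⁺(A)` and `U^γ = 1` n.e. on `A`. -/
def IsCapacitaryMeasure (κ : X → X → ℝ≥0∞) (A : Set X) (γ : Measure X) : Prop :=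
  memEplus κ γ ∧ Concentrated γ A ∧
    NearlyEverywhere κ A (fun x => potential κ γ x = 1)

/-- `A` is quasiclosed: approximable in outer capacity by closed sets. -/
def Quasiclosed (κ : X → X → ℝ≥0∞) (A : Set X) : Prop :=
  ∀ ε : ℝ≥0∞, 0 < ε → ∃ F : Set X, IsClosed F ∧ outerCap κ (symmDiff A F) < ε

/-- `A` is quasicompact: approximable in outer capacity by compact sets. -/
def Quasicompact (κ : X → X → ℝ≥0∞) (A : Set X) : Prop :=
  ∀ ε : ℝ≥0∞, 0 < ε → ∃ K : Set X, IsCompact K ∧ outerCap κ (symmDiff A K) < ε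


open scoped NNReal

section Fubini

/-- Regular measures are τ-smooth on open sets. -/
lemma measure_iUnion_of_directed_isOpen {ι : Type*} [Nonempty ι] (μ : Measure X) [μ.Regular]
    (U : ι → Set X) (hU : ∀ i, IsOpen (U i)) (hd : Directed (· ⊆ ·) U) :
    μ (⋃ i, U i) ≤ ⨆ i, μ (U i) := by
  refine le_of_forall_lt fun r hr => ?_
  obtain ⟨K, hK, hKc, hrK⟩ := (isOpen_iUnion hU).exists_lt_isCompact hr
  obtain ⟨i, hi⟩ := hKc.elim_directed_cover U hU hK hd
  exact hrK.trans_le ((measure_mono hi).trans (le_iSup (fun i => μ (U i)) i))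

variable [BorelSpace X]

/-- The dyadic staircase below `a`, as a sum of indicators of superlevel sets. -/
def staircase (n : ℕ) (a : ℝ≥0∞) : ℝ≥0∞ :=
  ∑ k ∈ Finset.range (n * 2 ^ n), (2 ^ n : ℝ≥0∞)⁻¹ * (Ioi ((k + 1 : ℝ≥0∞) / 2 ^ n)).indicator 1 a

lemma staircase_le (n : ℕ) (a : ℝ≥0∞) : staircase n a ≤ a := by
  unfold staircase
  have h2 : (2 ^ n : ℝ≥0∞) ≠ 0 := by positivity
  have h2' : (2 ^ n : ℝ≥0∞) ≠ ⊤ := by finiteness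
  have key : ∀ N : ℕ, ∑ k ∈ Finset.range N,
      (2 ^ n : ℝ≥0∞)⁻¹ * (Ioi ((k + 1 : ℝ≥0∞) / 2 ^ n)).indicator 1 a
        ≤ min a (N / 2 ^ n) := by
    intro N
    induction N with
    | zero => simp
    | succ N ih =>
      rw [Finset.sum_range_succ]
      have e : ((N + 1 : ℕ) : ℝ≥0∞) / 2 ^ n = N / 2 ^ n + (2 ^ n)⁻¹ := by
        rw [Nat.cast_add, Nat.cast_one, ENNReal.add_div, one_div]
      by_cases h : (N + 1 : ℝ≥0∞) / 2 ^ n < a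
      · rw [indicator_of_mem (mem_Ioi.2 h), Pi.one_apply, mul_one]
        have := ih.trans (min_le_right _ _)
        refine le_min ?_ ?_
        · refine (add_le_add_left this _).trans ?_
          rw [← e]; push_cast; exact h.le
        · rw [e]; exact add_le_add_left this _
      · rw [indicator_of_notMem (by simpa using h), mul_zero, add_zero]
        refine ih.trans (min_le_min le_rfl ?_)
        rw [e]; exact le_self_add
  exact (key _).trans (min_le_left _ _)

lemma eventually_le_staircase {a c : ℝ≥0∞} (h : c < a) : ∀ᶠ n in atTop, c ≤ staircase n a := by
  obtain ⟨b, hcb, hba⟩ := exists_between h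
  lift b to ℝ≥0 using hba.ne_top
  lift c to ℝ≥0 using hcb.ne_top
  have hcb' : c < b := ENNReal.coe_lt_coe.1 hcb
  obtain ⟨N₁, hN₁⟩ := exists_nat_ge b
  obtain ⟨N₂, hN₂⟩ := exists_pow_lt_of_lt_one (tsub_pos_of_lt hcb')
    (by norm_num : (1 / 2 : ℝ≥0) < 1)
  filter_upwards [eventually_ge_atTop N₁, eventually_ge_atTop N₂] with n hn₁ hn₂
  have hpow : ((1 / 2 : ℝ≥0)) ^ n < b - c :=
    (pow_le_pow_of_le_one (by norm_num) (by norm_num) hn₂).trans_lt hN₂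
  set M := ⌊b * 2 ^ n⌋₊ with hM
  have hMle : (M : ℝ≥0) ≤ b * 2 ^ n := Nat.floor_le (by positivity)
  have hMlt : b * 2 ^ n < M + 1 := Nat.lt_floor_add_one _
  have hMn : M ≤ n * 2 ^ n := by
    have : (M : ℝ≥0) ≤ (n : ℝ≥0) * 2 ^ n := hMle.trans (by
      gcongr; exact hN₁.trans (by exact_mod_cast hn₁))
    exact_mod_cast this
  have hlow : ((M : ℝ≥0∞)) / 2 ^ n ≤ staircase n a := by
    unfold staircase
    calc ((M : ℝ≥0∞)) / 2 ^ n
        = ∑ k ∈ Finset.range M, (2 ^ n : ℝ≥0∞)⁻¹ := by simp [div_eq_mul_inv]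
      _ = ∑ k ∈ Finset.range M,
          (2 ^ n : ℝ≥0∞)⁻¹ * (Ioi ((k + 1 : ℝ≥0∞) / 2 ^ n)).indicator 1 a := by
          refine Finset.sum_congr rfl fun k hk => ?_
          rw [indicator_of_mem, Pi.one_apply, mul_one]
          refine lt_of_le_of_lt ?_ hba
          refine ENNReal.div_le_of_le_mul ?_
          have hk' : ((k + 1 : ℕ) : ℝ≥0) ≤ b * 2 ^ n :=
            le_trans (by exact_mod_cast Finset.mem_range.1 hk) hMle
          exact_mod_cast hk'
      _ ≤ _ := Finset.sum_le_sum_of_subset (Finset.range_mono hMn)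
  refine le_trans ?_ hlow
  rw [ENNReal.le_div_iff_mul_le (Or.inl (by positivity)) (Or.inl (by finiteness))]
  have : c * 2 ^ n ≤ (M : ℝ≥0) := by
    have h1 : c + (1 / 2) ^ n ≤ b := by
      have := (lt_tsub_iff_left.1 hpow).le
      exact this
    have h2 : (c + (1 / 2) ^ n) * 2 ^ n ≤ b * 2 ^ n := by gcongr
    rw [add_mul, ← mul_pow] at h2
    norm_num at h2
    have h3 : c * 2 ^ n + 1 < M + 1 := h2.trans_lt hMlt
    exact (lt_of_add_lt_add_right h3).le
  exact_mod_cast this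

/-- Regular measures are τ-smooth on lower semicontinuous functions. -/
lemma lintegral_iSup_le_of_directed_lowerSemicontinuous {ι : Type*} [Nonempty ι] (μ : Measure X)
    [μ.Regular] (f : ι → X → ℝ≥0∞) (hf : ∀ i, LowerSemicontinuous (f i))
    (hd : Directed (· ≤ ·) f) :
    ∫⁻ x, ⨆ i, f i x ∂μ ≤ ⨆ i, ∫⁻ x, f i x ∂μ := by
  have hopen : ∀ i (t : ℝ≥0∞), IsOpen {x | t < f i x} := fun i t => (hf i).isOpen_preimage t
  have hset : ∀ t : ℝ≥0∞, {x | t < ⨆ i, f i x} = ⋃ i, {x | t < f i x} := by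
    intro t; ext x; simp [lt_iSup_iff]
  have hdir : ∀ t : ℝ≥0∞, Directed (· ⊆ ·) fun i => {x | t < f i x} := fun t i j => by
    obtain ⟨k, hik, hjk⟩ := hd i j
    exact ⟨k, fun x hx => lt_of_lt_of_le hx (hik x), fun x hx => lt_of_lt_of_le hx (hjk x)⟩
  have hmeas : ∀ n (g : X → ℝ≥0∞), (∀ t, IsOpen {x | t < g x}) →
      ∫⁻ x, staircase n (g x) ∂μ = ∑ k ∈ Finset.range (n * 2 ^ n),
        (2 ^ n : ℝ≥0∞)⁻¹ * μ {x | (k + 1 : ℝ≥0∞) / 2 ^ n < g x} := by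
    intro n g hg
    have e : ∀ (k : ℕ) x, (Ioi ((k + 1 : ℝ≥0∞) / 2 ^ n)).indicator (1 : ℝ≥0∞ → ℝ≥0∞) (g x)
        = {x | (k + 1 : ℝ≥0∞) / 2 ^ n < g x}.indicator 1 x := fun k x => by
      simp [indicator]
    simp only [staircase, e]
    rw [lintegral_finsetSum _ fun k _ =>
      (measurable_one.indicator (hg _).measurableSet).const_mul _]
    refine Finset.sum_congr rfl fun k _ => ?_
    rw [lintegral_const_mul _ (measurable_one.indicator (hg _).measurableSet),
      lintegral_indicator_one (hg _).measurableSet]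
  have hstep : ∀ n, ∫⁻ x, staircase n (⨆ i, f i x) ∂μ ≤ ⨆ i, ∫⁻ x, f i x ∂μ := by
    intro n
    rw [hmeas n _ fun t => by rw [hset]; exact isOpen_iUnion fun i => hopen i t]
    calc _ ≤ ∑ k ∈ Finset.range (n * 2 ^ n),
        ⨆ i, (2 ^ n : ℝ≥0∞)⁻¹ * μ {x | (k + 1 : ℝ≥0∞) / 2 ^ n < f i x} := by
          refine Finset.sum_le_sum fun k _ => ?_
          rw [← ENNReal.mul_iSup, hset]
          gcongr
          exact measure_iUnion_of_directed_isOpen μ _ (fun i => hopen i _) (hdir _)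
      _ = ⨆ i, ∑ k ∈ Finset.range (n * 2 ^ n),
          (2 ^ n : ℝ≥0∞)⁻¹ * μ {x | (k + 1 : ℝ≥0∞) / 2 ^ n < f i x} := by
          refine ENNReal.finsetSum_iSup fun i j => ?_
          obtain ⟨k, hik, hjk⟩ := hd i j
          refine ⟨k, fun a => ⟨?_, ?_⟩⟩
          · gcongr with x; exact hik x
          · gcongr with x; exact hjk x
      _ ≤ _ := by
          refine iSup_mono fun i => ?_
          rw [← hmeas n _ (hopen i)]
          exact lintegral_mono fun x => staircase_le n _
  have hstm : ∀ n, Measurable fun x => staircase n (⨆ i, f i x) := by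
    intro n
    have : Measurable (staircase n) := by
      unfold staircase
      exact Finset.measurable_sum _ fun k _ =>
        (measurable_one.indicator measurableSet_Ioi).const_mul _
    refine this.comp (measurable_of_Ioi fun t => ?_)
    change MeasurableSet {x | t < ⨆ i, f i x}
    rw [hset]
    exact (isOpen_iUnion fun i => hopen i t).measurableSet
  calc ∫⁻ x, ⨆ i, f i x ∂μ ≤ ∫⁻ x, liminf (fun n => staircase n (⨆ i, f i x)) atTop ∂μ :=
        lintegral_mono fun x => le_of_forall_lt_imp_le_of_dense fun c hc =>
          le_liminf_of_le (by isBoundedDefault) (eventually_le_staircase hc)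
    _ ≤ liminf (fun n => ∫⁻ x, staircase n (⨆ i, f i x) ∂μ) atTop := lintegral_liminf_le hstm
    _ ≤ _ := liminf_le_of_le (by isBoundedDefault) fun b hb => by
        obtain ⟨n, hn⟩ := hb.exists
        exact hn.trans (hstep n)

/-- The finite supremum of the functions `c · 1_{U × V}` for `(c, U, V)` in `s`. -/
def boxSup (s : Finset (ℝ≥0 × TopologicalSpace.Opens X × TopologicalSpace.Opens X))
    (z : X × X) : ℝ≥0∞ :=
  s.sup fun p => ((p.2.1 : Set X) ×ˢ (p.2.2 : Set X)).indicator (fun _ => (p.1 : ℝ≥0∞)) z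

/-- The finite suprema of boxes lying below `κ`. -/
def BoxMinorant (κ : X → X → ℝ≥0∞) : Type _ :=
  {s : Finset (ℝ≥0 × TopologicalSpace.Opens X × TopologicalSpace.Opens X) //
    ∀ z : X × X, boxSup s z ≤ κ z.1 z.2}

omit [MeasurableSpace X] [BorelSpace X] in
lemma directed_boxMinorant (κ : X → X → ℝ≥0∞) :
    Directed (· ≤ ·) fun s : BoxMinorant κ => boxSup s.1 := by
  classical
  intro s t
  refine ⟨⟨s.1 ∪ t.1, fun z => ?_⟩, fun z => ?_, fun z => ?_⟩
  · unfold boxSup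
    rw [Finset.sup_union]
    exact sup_le (s.2 z) (t.2 z)
  · exact Finset.sup_mono Finset.subset_union_left
  · exact Finset.sup_mono Finset.subset_union_right

instance (κ : X → X → ℝ≥0∞) : Nonempty (BoxMinorant κ) :=
  ⟨⟨∅, fun z => by simp [boxSup]⟩⟩

omit [MeasurableSpace X] [BorelSpace X] in
lemma iSup_boxMinorant {κ : X → X → ℝ≥0∞} (hκ : LowerSemicontinuous fun p : X × X => κ p.1 p.2)
    (z : X × X) : ⨆ s : BoxMinorant κ, boxSup s.1 z = κ z.1 z.2 := by
  refine le_antisymm (iSup_le fun s => s.2 z) (le_of_forall_lt_imp_le_of_dense fun c hc => ?_)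
  lift c to ℝ≥0 using hc.ne_top
  have hW : IsOpen {p : X × X | (c : ℝ≥0∞) < κ p.1 p.2} := hκ.isOpen_preimage c
  obtain ⟨U, V, hU, hV, hzU, hzV, hUV⟩ := isOpen_prod_iff.1 hW z.1 z.2 hc
  refine le_trans ?_ (le_iSup _ ⟨{(c, ⟨U, hU⟩, ⟨V, hV⟩)}, fun w => ?_⟩)
  · simp [boxSup, hzU, hzV]
  · simp only [boxSup, Finset.sup_singleton]
    exact indicator_le (g := fun w : X × X => κ w.1 w.2) (fun w hw => (hUV hw).le) w

omit [MeasurableSpace X] [BorelSpace X] in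
lemma lowerSemicontinuous_of_eventually_le {f : X → ℝ≥0∞}
    (h : ∀ x, ∀ᶠ y in 𝓝 x, f x ≤ f y) : LowerSemicontinuous f :=
  fun x _ hc => (h x).mono fun _ hy => hc.trans_le hy

omit [MeasurableSpace X] [BorelSpace X] in
lemma eventually_boxSup_le_left
    (s : Finset (ℝ≥0 × TopologicalSpace.Opens X × TopologicalSpace.Opens X)) (x : X) :
    ∀ᶠ x' in 𝓝 x, ∀ y, boxSup s (x, y) ≤ boxSup s (x', y) := by
  have : ∀ p ∈ s, ∀ᶠ x' in 𝓝 x, x ∈ p.2.1 → x' ∈ p.2.1 := fun p _ => by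
    by_cases hx : x ∈ p.2.1
    · filter_upwards [p.2.1.2.mem_nhds hx] with x' h _ using h
    · exact .of_forall fun _ h => absurd h hx
  filter_upwards [(Filter.eventually_all_finset s).2 this] with x' hx' y
  refine Finset.sup_mono_fun fun p hp => ?_
  by_cases h : (x, y) ∈ (p.2.1 : Set X) ×ˢ (p.2.2 : Set X)
  · rw [indicator_of_mem h, indicator_of_mem
      (show (x', y) ∈ (p.2.1 : Set X) ×ˢ (p.2.2 : Set X) from ⟨hx' p hp h.1, h.2⟩)]
  · rw [indicator_of_notMem h]; exact zero_le

omit [MeasurableSpace X] [BorelSpace X] in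
lemma lowerSemicontinuous_boxSup_right
    (s : Finset (ℝ≥0 × TopologicalSpace.Opens X × TopologicalSpace.Opens X)) (x : X) :
    LowerSemicontinuous fun y => boxSup s (x, y) := by
  refine lowerSemicontinuous_of_eventually_le fun y => ?_
  have : ∀ p ∈ s, ∀ᶠ y' in 𝓝 y, y ∈ p.2.2 → y' ∈ p.2.2 := fun p _ => by
    by_cases hy : y ∈ p.2.2
    · filter_upwards [p.2.2.2.mem_nhds hy] with y' h _ using h
    · exact .of_forall fun _ h => absurd h hy
  filter_upwards [(Filter.eventually_all_finset s).2 this] with y' hy'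
  refine Finset.sup_mono_fun fun p hp => ?_
  by_cases h : (x, y) ∈ (p.2.1 : Set X) ×ˢ (p.2.2 : Set X)
  · rw [indicator_of_mem h, indicator_of_mem
      (show (x, y') ∈ (p.2.1 : Set X) ×ˢ (p.2.2 : Set X) from ⟨h.1, hy' p hp h.2⟩)]
  · rw [indicator_of_notMem h]; exact zero_le

lemma measurable_boxSup
    (s : Finset (ℝ≥0 × TopologicalSpace.Opens X × TopologicalSpace.Opens X)) :
    Measurable (boxSup s) := by
  unfold boxSup
  simp only [Finset.sup_eq_iSup]
  exact Measurable.biSup _ s.countable_toSet fun p _ =>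
    measurable_const.indicator (p.2.1.2.measurableSet.prod p.2.2.2.measurableSet)

variable {κ : X → X → ℝ≥0∞} {μ ν : Measure X}

lemma potential_eq_iSup (hκ : LowerSemicontinuous fun p : X × X => κ p.1 p.2) [ν.Regular]
    (x : X) : potential κ ν x = ⨆ s : BoxMinorant κ, ∫⁻ y, boxSup s.1 (x, y) ∂ν := by
  refine le_antisymm ?_ (iSup_le fun s => lintegral_mono fun y => s.2 (x, y))
  unfold potential
  simp_rw [← iSup_boxMinorant hκ (x, _)]
  refine lintegral_iSup_le_of_directed_lowerSemicontinuous ν _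
    (fun s => lowerSemicontinuous_boxSup_right s.1 x) fun s t => ?_
  obtain ⟨u, hu, hv⟩ := directed_boxMinorant κ s t
  exact ⟨u, fun y => hu (x, y), fun y => hv (x, y)⟩

omit [BorelSpace X] in
lemma lowerSemicontinuous_lintegral_boxSup
    (s : Finset (ℝ≥0 × TopologicalSpace.Opens X × TopologicalSpace.Opens X)) (ν : Measure X) :
    LowerSemicontinuous fun x => ∫⁻ y, boxSup s (x, y) ∂ν :=
  lowerSemicontinuous_of_eventually_le fun x =>
    (eventually_boxSup_le_left s x).mono fun _ h => lintegral_mono h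

lemma lowerSemicontinuous_potential (hκ : LowerSemicontinuous fun p : X × X => κ p.1 p.2)
    [ν.Regular] : LowerSemicontinuous (potential κ ν) := by
  rw [show potential κ ν = fun x => ⨆ s : BoxMinorant κ, ∫⁻ y, boxSup s.1 (x, y) ∂ν from
    funext (potential_eq_iSup hκ)]
  exact lowerSemicontinuous_iSup fun s => lowerSemicontinuous_lintegral_boxSup s.1 ν

lemma lintegral_potential_eq_iSup (hκ : LowerSemicontinuous fun p : X × X => κ p.1 p.2)
    [μ.Regular] [ν.Regular] : ∫⁻ x, potential κ ν x ∂μ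
      = ⨆ s : BoxMinorant κ, ∫⁻ x, ∫⁻ y, boxSup s.1 (x, y) ∂ν ∂μ := by
  simp_rw [potential_eq_iSup hκ]
  refine le_antisymm ?_
    (iSup_le fun s => lintegral_mono fun x => le_iSup (fun t : BoxMinorant κ =>
      ∫⁻ y, boxSup t.1 (x, y) ∂ν) s)
  refine lintegral_iSup_le_of_directed_lowerSemicontinuous μ _
    (fun s => lowerSemicontinuous_lintegral_boxSup s.1 ν) fun s t => ?_
  obtain ⟨u, hu, hv⟩ := directed_boxMinorant κ s t
  exact ⟨u, fun x => lintegral_mono fun y => hu (x, y), fun x => lintegral_mono fun y => hv (x, y)⟩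

/-- Fubini's theorem for a lower semicontinuous kernel, which need not be measurable for the
product σ-algebra. -/
lemma mutualEnergy_eq_lintegral_potential_of_aemeasurable
    (hκ : LowerSemicontinuous fun p : X × X => κ p.1 p.2) [μ.Regular] [ν.Regular]
    (h : AEMeasurable (fun x : X => Measure.map (Prod.mk x) ν) μ) :
    mutualEnergy κ μ ν = ∫⁻ x, potential κ ν x ∂μ := by
  have key : ∀ g : X × X → ℝ≥0∞, Measurable g →
      ∫⁻ z, g z ∂(μ.prod ν) = ∫⁻ x, ∫⁻ y, g (x, y) ∂ν ∂μ := fun g hg => by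
    rw [Measure.prod, Measure.lintegral_bind h hg.aemeasurable]
    exact lintegral_congr fun x => lintegral_map hg measurable_prodMk_left
  refine le_antisymm ?_ ?_
  · obtain ⟨g, hg, hle, he⟩ := exists_measurable_le_lintegral_eq (μ := μ.prod ν)
      fun p : X × X => κ p.1 p.2
    rw [mutualEnergy, he, key g hg]
    exact lintegral_mono fun x => lintegral_mono fun y => hle (x, y)
  · rw [lintegral_potential_eq_iSup hκ]
    refine iSup_le fun s => ?_
    rw [← key _ (measurable_boxSup s.1)]
    exact lintegral_mono s.2

lemma mutualEnergy_eq_lintegral_potential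
    (hκ : LowerSemicontinuous fun p : X × X => κ p.1 p.2) [μ.Regular] [ν.Regular] [SFinite ν] :
    mutualEnergy κ μ ν = ∫⁻ x, potential κ ν x ∂μ :=
  mutualEnergy_eq_lintegral_potential_of_aemeasurable hκ Measurable.map_prodMk_left.aemeasurable

omit [TopologicalSpace X] [BorelSpace X] in
lemma mutualEnergy_comm (hκ : ∀ x y, κ x y = κ y x) [SFinite μ] [SFinite ν] :
    mutualEnergy κ μ ν = mutualEnergy κ ν μ := by
  unfold mutualEnergy
  rw [← Measure.prod_swap]
  change ∫⁻ p, _ ∂(Measure.map MeasurableEquiv.prodComm _) = _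
  rw [lintegral_map_equiv]
  exact lintegral_congr fun p => hκ _ _

end Fubini

section FiniteEnergy

lemma regular_add {μ ν : Measure X} [hμ : μ.Regular] [hν : ν.Regular] : (μ + ν).Regular where
  lt_top_of_isCompact K hK := by
    rw [Measure.add_apply]
    exact ENNReal.add_lt_top.2 ⟨hK.measure_lt_top, hK.measure_lt_top⟩
  outerRegular A _ r hr := by
    rw [Measure.add_apply] at hr
    have hA : μ A ≠ ⊤ := ((le_self_add.trans_lt hr).trans_le le_top).ne
    have hA' : ν A ≠ ⊤ := ((le_add_self.trans_lt hr).trans_le le_top).ne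
    have hδ : (r - (μ A + ν A)) / 2 ≠ 0 :=
      (ENNReal.div_pos (tsub_pos_of_lt hr).ne' ofNat_ne_top).ne'
    obtain ⟨U, hAU, hU, hμU⟩ := A.exists_isOpen_lt_add hA hδ
    obtain ⟨V, hAV, hV, hνV⟩ := A.exists_isOpen_lt_add hA' hδ
    refine ⟨U ∩ V, subset_inter hAU hAV, hU.inter hV, ?_⟩
    rw [Measure.add_apply]
    calc μ (U ∩ V) + ν (U ∩ V) ≤ μ U + ν V :=
          add_le_add (measure_mono inter_subset_left) (measure_mono inter_subset_right)
      _ < (μ A + (r - (μ A + ν A)) / 2) + (ν A + (r - (μ A + ν A)) / 2) :=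
          ENNReal.add_lt_add hμU hνV
      _ = r := by
          rw [add_add_add_comm, ENNReal.add_halves, add_tsub_cancel_of_le hr.le]
  innerRegular := fun U hU r hr => by
    rw [Measure.add_apply] at hr
    by_cases h₁ : μ U = 0
    · rw [h₁, zero_add] at hr
      obtain ⟨K, hKU, hK, hrK⟩ := hU.exists_lt_isCompact hr
      exact ⟨K, hKU, hK, hrK.trans_le le_add_self⟩
    by_cases h₂ : ν U = 0
    · rw [h₂, add_zero] at hr
      obtain ⟨K, hKU, hK, hrK⟩ := hU.exists_lt_isCompact hr
      exact ⟨K, hKU, hK, hrK.trans_le le_self_add⟩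
    obtain ⟨a, ha, b, hb, hab⟩ := ENNReal.exists_lt_add_of_lt_add hr h₁ h₂
    obtain ⟨K, hKU, hK, haK⟩ := hU.exists_lt_isCompact ha
    obtain ⟨L, hLU, hL, hbL⟩ := hU.exists_lt_isCompact hb
    refine ⟨K ∪ L, union_subset hKU hLU, hK.union hL, hab.trans_le ?_⟩
    rw [Measure.add_apply]
    exact add_le_add (haK.le.trans (measure_mono subset_union_left))
      (hbL.le.trans (measure_mono subset_union_right))

lemma regular_dirac [T1Space X] [BorelSpace X] (x : X) : (Measure.dirac x).Regular where
  outerRegular A hA r hr := by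
    by_cases hx : x ∈ A
    · exact ⟨univ, subset_univ _, isOpen_univ, by simpa [hx] using hr⟩
    · exact ⟨{x}ᶜ, fun y hy h => hx (h ▸ hy), isOpen_compl_singleton,
        by simpa [hx, isOpen_compl_singleton.measurableSet] using hr⟩
  innerRegular := fun U hU r hr => by
    have hx : x ∈ U := by
      by_contra h
      simp [hU.measurableSet, h] at hr
    exact ⟨{x}, by simpa using hx, isCompact_singleton, by simpa [hU.measurableSet, hx] using hr⟩

variable [T2Space X] [BorelSpace X] {κ : X → X → ℝ≥0∞} {μ ν ρ : Measure X}

omit [TopologicalSpace X] [T2Space X] [BorelSpace X] in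
lemma mutualEnergy_zero_right : mutualEnergy κ μ 0 = 0 := by simp [mutualEnergy]

omit [T2Space X] [BorelSpace X] in
lemma memEplus_zero : memEplus κ (0 : Measure X) :=
  ⟨inferInstanceAs (Measure.Regular 0), by simp [energy, mutualEnergy]⟩

omit [T2Space X] [BorelSpace X] in
lemma EnergyPrinciple.eq_zero (hE : EnergyPrinciple κ) (hμ : μ.Regular) (h : energy κ μ = 0) :
    μ = 0 :=
  (hE μ 0 ⟨hμ, h ▸ zero_lt_top⟩ memEplus_zero).2 (by
    rw [mutualEnergy_zero_right, h]; simp [energy, mutualEnergy])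

lemma EnergyPrinciple.diag_pos (hκ : LowerSemicontinuous fun p : X × X => κ p.1 p.2)
    (hE : EnergyPrinciple κ) (x : X) : 0 < κ x x := by
  have := regular_dirac x
  refine pos_iff_ne_zero.2 fun h => ?_
  have hm : ∀ y, Measurable (κ y) := fun y =>
    (hκ.comp (Continuous.prodMk_right y)).measurable
  have he : energy κ (Measure.dirac x) = 0 := by
    rw [energy, mutualEnergy_eq_lintegral_potential hκ,
      lintegral_dirac' _ (lowerSemicontinuous_potential hκ).measurable, potential,
      lintegral_dirac' _ (hm x), h]
  have := congrArg (fun m : Measure X => m univ) (hE.eq_zero this he)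
  simp at this

/-- Under the energy principle, measures of finite energy are σ-finite. -/
lemma memEplus.sigmaFinite (hκ : LowerSemicontinuous fun p : X × X => κ p.1 p.2)
    (hE : EnergyPrinciple κ) (hμ : memEplus κ μ) : SigmaFinite μ := by
  have := hμ.1
  change μ.Regular at this
  have hae : AEMeasurable (fun x : X => Measure.map (Prod.mk x) μ) μ := by
    by_contra h
    have h0 : energy κ μ = 0 := by
      rw [energy, mutualEnergy, Measure.prod, Measure.bind, Measure.map_of_not_aemeasurable h,
        Measure.join_zero, lintegral_zero_measure]
    rw [hE.eq_zero hμ.1 h0] at h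
    exact h aemeasurable_zero_measure
  have hU := lowerSemicontinuous_potential (ν := μ) hκ
  have hI : ∫⁻ x, potential κ μ x ∂μ < ⊤ := by
    rw [← mutualEnergy_eq_lintegral_potential_of_aemeasurable hκ hae]; exact hμ.2
  set O : Set X := ⋃₀ {V | IsOpen V ∧ μ V = 0}
  have hO : IsOpen O := isOpen_sUnion fun V hV => hV.1
  have hO0 : μ O = 0 := by
    by_contra h
    obtain ⟨K, hKO, hK, hK0⟩ := hO.exists_lt_isCompact (pos_iff_ne_zero.2 h)
    refine hK0.ne' (hK.measure_zero_of_nhdsWithin fun x hx => ?_)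
    obtain ⟨V, hV, hxV⟩ := hKO hx
    exact ⟨V, mem_nhdsWithin_of_mem_nhds (hV.1.mem_nhds hxV), hV.2⟩
  have hpos : ∀ x ∉ O, 0 < potential κ μ x := by
    intro x hx
    refine pos_iff_ne_zero.2 fun h => hx ?_
    obtain ⟨c, hc0, hc⟩ := exists_between (hE.diag_pos hκ x)
    obtain ⟨U, V, hU, hV, hxU, hxV, hUV⟩ :=
      isOpen_prod_iff.1 (hκ.isOpen_preimage c) x x hc
    refine ⟨V, ⟨hV, ?_⟩, hxV⟩
    have : c * μ V ≤ potential κ μ x := by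
      rw [← setLIntegral_const, potential]
      exact (setLIntegral_mono' hV.measurableSet fun y hy =>
        (show c < κ x y from hUV (mk_mem_prod hxU hy)).le).trans (setLIntegral_le_lintegral _ _)
    rw [h, nonpos_iff_eq_zero, mul_eq_zero] at this
    exact this.resolve_left hc0.ne'
  refine ⟨⟨⟨fun n : ℕ => O ∪ {x | (n + 1 : ℝ≥0∞)⁻¹ ≤ potential κ μ x}, fun _ => trivial,
    fun n => ?_, ?_⟩⟩⟩
  · refine (measure_union_le _ _).trans_lt ?_
    rw [hO0, zero_add]
    exact (meas_ge_le_lintegral_div hU.measurable.aemeasurable (by simp) (by simp)).trans_lt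
      (ENNReal.div_lt_top hI.ne (by simp))
  · refine eq_univ_of_forall fun x => mem_iUnion.2 ?_
    by_cases hx : x ∈ O
    · exact ⟨0, Or.inl hx⟩
    · obtain ⟨n, hn⟩ := ENNReal.exists_inv_nat_lt (hpos x hx).ne'
      refine ⟨n, Or.inr (le_trans ?_ hn.le)⟩
      gcongr
      exact le_self_add

lemma mutualEnergy_eq (hker : IsKernel κ) (hE : EnergyPrinciple κ) (hμ : memEplus κ μ)
    (hν : memEplus κ ν) : mutualEnergy κ μ ν = ∫⁻ x, potential κ ν x ∂μ := by
  have : μ.Regular := hμ.1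
  have : ν.Regular := hν.1
  have := hν.sigmaFinite hker.2 hE
  exact mutualEnergy_eq_lintegral_potential hker.2

lemma mutualEnergy_comm' (hker : IsKernel κ) (hE : EnergyPrinciple κ) (hμ : memEplus κ μ)
    (hν : memEplus κ ν) : mutualEnergy κ μ ν = mutualEnergy κ ν μ := by
  have := hμ.sigmaFinite hker.2 hE
  have := hν.sigmaFinite hker.2 hE
  exact mutualEnergy_comm hker.1

omit [T2Space X] [BorelSpace X] in
lemma mutualEnergy_ne_top (hE : EnergyPrinciple κ) (hμ : memEplus κ μ) (hν : memEplus κ ν) :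
    mutualEnergy κ μ ν ≠ ⊤ := by
  have h := (hE μ ν hμ hν).1.trans_lt (ENNReal.add_lt_top.2 ⟨hμ.2, hν.2⟩)
  rw [two_mul] at h
  exact (ENNReal.add_lt_top.1 h).1.ne

omit [T2Space X] in
lemma mutualEnergy_add_left (hker : IsKernel κ) [μ.Regular] [ν.Regular] [ρ.Regular] [SFinite ρ] :
    mutualEnergy κ (μ + ν) ρ = mutualEnergy κ μ ρ + mutualEnergy κ ν ρ := by
  have : (μ + ν).Regular := regular_add
  simp only [mutualEnergy_eq_lintegral_potential hker.2, lintegral_add_measure]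

omit [TopologicalSpace X] [T2Space X] [BorelSpace X] in
lemma mutualEnergy_smul_left [SFinite ρ] (c : ℝ≥0∞) :
    mutualEnergy κ (c • μ) ρ = c * mutualEnergy κ μ ρ := by
  simp only [mutualEnergy, Measure.prod_smul_left, lintegral_smul_measure, smul_eq_mul]

lemma memEplus.add (hker : IsKernel κ) (hE : EnergyPrinciple κ) (hμ : memEplus κ μ)
    (hν : memEplus κ ν) : memEplus κ (μ + ν) := by
  have : μ.Regular := hμ.1
  have : ν.Regular := hν.1
  have := hμ.sigmaFinite hker.2 hE
  have := hν.sigmaFinite hker.2 hE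
  have h : (μ + ν).Regular := regular_add
  refine ⟨h, ?_⟩
  rw [energy, mutualEnergy_add_left hker, mutualEnergy_comm hker.1,
    mutualEnergy_add_left hker, mutualEnergy_comm (μ := ν) (ν := μ + ν) hker.1,
    mutualEnergy_add_left hker]
  have h1 := mutualEnergy_ne_top hE hμ hμ
  have h2 := mutualEnergy_ne_top hE hμ hν
  have h3 := mutualEnergy_ne_top hE hν hμ
  have h4 := mutualEnergy_ne_top hE hν hν
  finiteness

lemma memEplus.smul (hker : IsKernel κ) (hE : EnergyPrinciple κ) (hμ : memEplus κ μ)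
    {c : ℝ≥0∞} (hc : c ≠ ⊤) : memEplus κ (c • μ) := by
  have : μ.Regular := hμ.1
  have := hμ.sigmaFinite hker.2 hE
  refine ⟨Measure.Regular.smul hc, ?_⟩
  have : SFinite (c • μ) := inferInstance
  rw [energy, mutualEnergy_smul_left, mutualEnergy_comm hker.1, mutualEnergy_smul_left]
  have h1 := mutualEnergy_ne_top hE hμ hμ
  finiteness

/-- The mutual energy as a real number. -/
def realEnergy (κ : X → X → ℝ≥0∞) (μ ν : Measure X) : ℝ := (mutualEnergy κ μ ν).toReal

/-- The squared strong distance. -/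
def sqDist (κ : X → X → ℝ≥0∞) (μ ν : Measure X) : ℝ :=
  realEnergy κ μ μ + realEnergy κ ν ν - 2 * realEnergy κ μ ν

lemma realEnergy_comm (hker : IsKernel κ) (hE : EnergyPrinciple κ) (hμ : memEplus κ μ)
    (hν : memEplus κ ν) : realEnergy κ μ ν = realEnergy κ ν μ :=
  congrArg ENNReal.toReal (mutualEnergy_comm' hker hE hμ hν)

lemma realEnergy_add_left (hker : IsKernel κ) (hE : EnergyPrinciple κ) (hμ : memEplus κ μ)
    (hν : memEplus κ ν) (hρ : memEplus κ ρ) :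
    realEnergy κ (μ + ν) ρ = realEnergy κ μ ρ + realEnergy κ ν ρ := by
  have : μ.Regular := hμ.1
  have : ν.Regular := hν.1
  have : ρ.Regular := hρ.1
  have := hρ.sigmaFinite hker.2 hE
  rw [realEnergy, mutualEnergy_add_left hker,
    ENNReal.toReal_add (mutualEnergy_ne_top hE hμ hρ) (mutualEnergy_ne_top hE hν hρ)]
  rfl

lemma realEnergy_add_right (hker : IsKernel κ) (hE : EnergyPrinciple κ) (hμ : memEplus κ μ)
    (hν : memEplus κ ν) (hρ : memEplus κ ρ) :
    realEnergy κ ρ (μ + ν) = realEnergy κ ρ μ + realEnergy κ ρ ν := by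
  rw [realEnergy_comm hker hE hρ (hμ.add hker hE hν), realEnergy_add_left hker hE hμ hν hρ,
    realEnergy_comm hker hE hμ hρ, realEnergy_comm hker hE hν hρ]

lemma realEnergy_smul_left (hker : IsKernel κ) (hE : EnergyPrinciple κ) (hρ : memEplus κ ρ)
    (c : ℝ≥0∞) : realEnergy κ (c • μ) ρ = c.toReal * realEnergy κ μ ρ := by
  have := hρ.sigmaFinite hker.2 hE
  rw [realEnergy, mutualEnergy_smul_left, ENNReal.toReal_mul]
  rfl

lemma realEnergy_smul_right (hker : IsKernel κ) (hE : EnergyPrinciple κ) (hμ : memEplus κ μ)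
    (hρ : memEplus κ ρ) {c : ℝ≥0∞} (hc : c ≠ ⊤) :
    realEnergy κ ρ (c • μ) = c.toReal * realEnergy κ ρ μ := by
  rw [realEnergy_comm hker hE hρ (hμ.smul hker hE hc), realEnergy_smul_left hker hE hρ,
    realEnergy_comm hker hE hμ hρ]

omit [T2Space X] [BorelSpace X] in
lemma sqDist_nonneg (hE : EnergyPrinciple κ) (hμ : memEplus κ μ) (hν : memEplus κ ν) :
    0 ≤ sqDist κ μ ν := by
  have h := ENNReal.toReal_mono (ENNReal.add_lt_top.2 ⟨hμ.2, hν.2⟩).ne (hE μ ν hμ hν).1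
  rw [ENNReal.toReal_add hμ.2.ne hν.2.ne, ENNReal.toReal_mul] at h
  exact sub_nonneg.2 h

omit [T2Space X] [BorelSpace X] in
lemma eq_of_sqDist_nonpos (hE : EnergyPrinciple κ) (hμ : memEplus κ μ) (hν : memEplus κ ν)
    (h : sqDist κ μ ν ≤ 0) : μ = ν := by
  refine (hE μ ν hμ hν).2 (le_antisymm (hE μ ν hμ hν).1 ?_)
  have h2 : 2 * mutualEnergy κ μ ν ≠ ⊤ := ENNReal.mul_ne_top ofNat_ne_top
    (mutualEnergy_ne_top hE hμ hν)
  rw [← ENNReal.toReal_le_toReal (ENNReal.add_lt_top.2 ⟨hμ.2, hν.2⟩).ne h2,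
    ENNReal.toReal_add hμ.2.ne hν.2.ne, ENNReal.toReal_mul]
  exact sub_nonpos.1 h

/-- The Cauchy–Schwarz inequality for the energy form applied to `μ - ν` and `ρ`. -/
lemma sq_realEnergy_sub_le (hker : IsKernel κ) (hE : EnergyPrinciple κ) (hμ : memEplus κ μ)
    (hν : memEplus κ ν) (hρ : memEplus κ ρ) :
    (realEnergy κ μ ρ - realEnergy κ ν ρ) ^ 2 ≤ sqDist κ μ ν * realEnergy κ ρ ρ := by
  have key : ∀ {μ ν : Measure X}, memEplus κ μ → memEplus κ ν → ∀ t : ℝ, 0 ≤ t →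
      0 ≤ realEnergy κ ρ ρ * (t * t) + 2 * (realEnergy κ μ ρ - realEnergy κ ν ρ) * t
        + sqDist κ μ ν := by
    intro μ ν hμ hν t ht
    have hρt := hρ.smul hker hE (c := ENNReal.ofReal t) ofReal_ne_top
    have hμt := hμ.add hker hE hρt
    have h := sqDist_nonneg hE hμt hν
    rw [sqDist, realEnergy_add_left hker hE hμ hρt hμt, realEnergy_add_left hker hE hμ hρt hν,
      realEnergy_add_right hker hE hμ hρt hμ, realEnergy_add_right hker hE hμ hρt hρt,
      realEnergy_smul_left hker hE hν, realEnergy_smul_left hker hE hμ,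
      realEnergy_smul_left hker hE hρt, realEnergy_smul_right hker hE hρ hμ ofReal_ne_top,
      realEnergy_smul_right hker hE hρ hρ ofReal_ne_top, ENNReal.toReal_ofReal ht,
      realEnergy_comm hker hE hρ hμ, realEnergy_comm hker hE hρ hν] at h
    rw [sqDist]
    linarith
  have hall : ∀ t : ℝ, 0 ≤ realEnergy κ ρ ρ * (t * t)
      + 2 * (realEnergy κ μ ρ - realEnergy κ ν ρ) * t + sqDist κ μ ν := by
    intro t
    rcases le_total 0 t with ht | ht
    · exact key hμ hν t ht
    · have h := key hν hμ (-t) (neg_nonneg.2 ht)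
      have hs : sqDist κ ν μ = sqDist κ μ ν := by
        rw [sqDist, sqDist, realEnergy_comm hker hE hν hμ]; ring
      rw [hs] at h
      linarith
  have := discrim_le_zero hall
  rw [discrim] at this
  linarith

omit [T2Space X] [BorelSpace X] in
lemma tendsto_sqDist (hE : EnergyPrinciple κ) {m : ℕ → Measure X}
    (hm : ∀ n, memEplus κ (m n)) (hμ : memEplus κ μ) (h : StrongTendstoSeq κ m μ) :
    Tendsto (fun n => sqDist κ (m n) μ) atTop (𝓝 0) := by
  have h2 := h.pow 2
  rw [zero_pow two_ne_zero] at h2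
  exact h2.congr fun n => Real.sq_sqrt (sqDist_nonneg hE (hm n) hμ)

/-- Strong convergence implies weak convergence. -/
lemma tendsto_realEnergy (hker : IsKernel κ) (hE : EnergyPrinciple κ) {m : ℕ → Measure X}
    (hm : ∀ n, memEplus κ (m n)) (hμ : memEplus κ μ) (h : StrongTendstoSeq κ m μ)
    (hρ : memEplus κ ρ) :
    Tendsto (fun n => realEnergy κ (m n) ρ) atTop (𝓝 (realEnergy κ μ ρ)) := by
  rw [tendsto_iff_norm_sub_tendsto_zero]
  have h1 := (((tendsto_sqDist hE hm hμ h).mul_const (realEnergy κ ρ ρ))).sqrt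
  rw [zero_mul, Real.sqrt_zero] at h1
  exact squeeze_zero (fun n => norm_nonneg _)
    (fun n => Real.abs_le_sqrt (sq_realEnergy_sub_le hker hE (hm n) hμ hρ)) h1

lemma tendsto_realEnergy_self (hker : IsKernel κ) (hE : EnergyPrinciple κ) {m : ℕ → Measure X}
    (hm : ∀ n, memEplus κ (m n)) (hμ : memEplus κ μ) (h : StrongTendstoSeq κ m μ) :
    Tendsto (fun n => realEnergy κ (m n) (m n)) atTop (𝓝 (realEnergy κ μ μ)) := by
  have h1 := ((tendsto_sqDist hE hm hμ h).sub_const (realEnergy κ μ μ)).add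
    ((tendsto_realEnergy hker hE hm hμ h hμ).const_mul 2)
  convert h1 using 2
  · rw [sqDist]; ring
  · ring

omit [T2Space X] [BorelSpace X] in
lemma Concentrated.add {A : Set X} (hμ : Concentrated μ A) (hν : Concentrated ν A) :
    Concentrated (μ + ν) A := fun K hK => by
  rw [Measure.add_apply, hμ K hK, hν K hK, add_zero]

omit [T2Space X] [BorelSpace X] in
lemma Concentrated.smul {A : Set X} (hμ : Concentrated μ A) (c : ℝ≥0∞) :
    Concentrated (c • μ) A := fun K hK => by
  rw [Measure.smul_apply, hμ K hK, smul_zero]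

/-- The convex combination `(1 - t) μ + t ν`. -/
def mix (t : ℝ) (μ ν : Measure X) : Measure X :=
  ENNReal.ofReal (1 - t) • μ + ENNReal.ofReal t • ν

lemma memBreve.mix (hker : IsKernel κ) (hE : EnergyPrinciple κ) {A : Set X} {t : ℝ}
    (ht : t ∈ Icc (0 : ℝ) 1) (hμ : memBreve κ A μ) (hν : memBreve κ A ν) :
    memBreve κ A (mix t μ ν) := by
  refine ⟨(hμ.1.smul hker hE ofReal_ne_top).add hker hE (hν.1.smul hker hE ofReal_ne_top),
    (hμ.2.1.smul _).add (hν.2.1.smul _), ?_⟩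
  rw [GaussVar.mix, Measure.add_apply, Measure.smul_apply, Measure.smul_apply, hμ.2.2, hν.2.2,
    smul_eq_mul, smul_eq_mul, mul_one, mul_one, ← ofReal_add (sub_nonneg.2 ht.2) ht.1]
  simp

lemma realEnergy_mix (hker : IsKernel κ) (hE : EnergyPrinciple κ) {t : ℝ}
    (ht : t ∈ Icc (0 : ℝ) 1) (hμ : memEplus κ μ) (hν : memEplus κ ν) :
    realEnergy κ (mix t μ ν) (mix t μ ν) = (1 - t) ^ 2 * realEnergy κ μ μ
      + 2 * t * (1 - t) * realEnergy κ μ ν + t ^ 2 * realEnergy κ ν ν := by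
  have h1 := hμ.smul hker hE (c := ENNReal.ofReal (1 - t)) ofReal_ne_top
  have h2 := hν.smul hker hE (c := ENNReal.ofReal t) ofReal_ne_top
  have h3 := h1.add hker hE h2
  rw [mix, realEnergy_add_left hker hE h1 h2 h3, realEnergy_smul_left hker hE h3,
    realEnergy_smul_left hker hE h3, realEnergy_add_right hker hE h1 h2 hμ,
    realEnergy_add_right hker hE h1 h2 hν, realEnergy_smul_right hker hE hμ hμ ofReal_ne_top,
    realEnergy_smul_right hker hE hν hμ ofReal_ne_top,
    realEnergy_smul_right hker hE hμ hν ofReal_ne_top,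
    realEnergy_smul_right hker hE hν hν ofReal_ne_top, realEnergy_comm hker hE hν hμ,
    ENNReal.toReal_ofReal (sub_nonneg.2 ht.2), ENNReal.toReal_ofReal ht.1]
  ring

omit [T2Space X] [BorelSpace X] in
lemma wcap_toReal_le {A : Set X} (hμ : memBreve κ A μ) :
    (wcap κ A).toReal ≤ realEnergy κ μ μ :=
  ENNReal.toReal_mono hμ.1.2.ne (iInf₂_le μ hμ)

omit [T2Space X] [BorelSpace X] in
lemma exists_memBreve_energy_lt {A : Set X} {c : ℝ≥0∞} (h : wcap κ A < c) :
    ∃ μ, memBreve κ A μ ∧ energy κ μ < c := by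
  simpa only [wcap, iInf_lt_iff, exists_prop] using h

lemma sqDist_le_of_memBreve (hker : IsKernel κ) (hE : EnergyPrinciple κ) {A : Set X}
    (hμ : memBreve κ A μ) (hν : memBreve κ A ν) :
    sqDist κ μ ν ≤ 2 * realEnergy κ μ μ + 2 * realEnergy κ ν ν - 4 * (wcap κ A).toReal := by
  have ht : (1 / 2 : ℝ) ∈ Icc (0 : ℝ) 1 := by norm_num
  have h := wcap_toReal_le (hμ.mix hker hE ht hν)
  rw [realEnergy_mix hker hE ht hμ.1 hν.1] at h
  rw [sqDist]
  linarith

/-- A minimizing sequence of unit measures converges strongly; the limit has minimal energy and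
satisfies the variational inequality, although mass may be lost. -/
lemma exists_limit_of_minimizing (hker : IsKernel κ) (hperf : IsPerfect κ) {A : Set X}
    {m : ℕ → Measure X} (hm : ∀ n, memBreve κ A (m n))
    (hlim : Tendsto (fun n => realEnergy κ (m n) (m n)) atTop (𝓝 (wcap κ A).toReal)) :
    ∃ μ, memEplus κ μ ∧ StrongTendstoSeq κ m μ ∧ realEnergy κ μ μ = (wcap κ A).toReal ∧
      ∀ ρ, memBreve κ A ρ → (wcap κ A).toReal ≤ realEnergy κ μ ρ := by
  have hE := hperf.1
  set w := (wcap κ A).toReal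
  have hmE := fun n => (hm n).1
  have hC : StrongCauchySeq κ m := by
    intro ε hε
    obtain ⟨N, hN⟩ := eventually_atTop.1 (hlim.eventually_lt_const
      (show w < w + ε ^ 2 / 4 from lt_add_of_pos_right _ (by positivity)))
    refine ⟨N, fun i hi j hj => ?_⟩
    change √(sqDist κ (m i) (m j)) < ε
    rw [Real.sqrt_lt' hε]
    have := sqDist_le_of_memBreve hker hE (hm i) (hm j)
    linarith [hN i hi, hN j hj]
  obtain ⟨μ, hμ, hconv⟩ := hperf.2.1 m hmE hC
  have hself : realEnergy κ μ μ = w :=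
    tendsto_nhds_unique (tendsto_realEnergy_self hker hE hmE hμ hconv) hlim
  refine ⟨μ, hμ, hconv, hself, fun ρ hρ => ?_⟩
  have hq : ∀ t ∈ Ioc (0 : ℝ) 1,
      w * (2 - t) ≤ 2 * (1 - t) * realEnergy κ μ ρ + t * realEnergy κ ρ ρ := by
    intro t ht
    have h1 : ∀ n, w ≤ (1 - t) ^ 2 * realEnergy κ (m n) (m n)
        + 2 * t * (1 - t) * realEnergy κ (m n) ρ + t ^ 2 * realEnergy κ ρ ρ := fun n => by
      rw [← realEnergy_mix hker hE (Ioc_subset_Icc_self ht) (hmE n) hρ.1]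
      exact wcap_toReal_le ((hm n).mix hker hE (Ioc_subset_Icc_self ht) hρ)
    have h2 := ge_of_tendsto' (((hlim.const_mul ((1 - t) ^ 2)).add
      ((tendsto_realEnergy hker hE hmE hμ hconv hρ.1).const_mul (2 * t * (1 - t)))).add_const _) h1
    refine le_of_mul_le_mul_left ?_ ht.1
    linarith
  have hl : Tendsto (fun t : ℝ => 2 * (1 - t) * realEnergy κ μ ρ + t * realEnergy κ ρ ρ
      - w * (2 - t)) (𝓝[>] 0) (𝓝 (2 * (1 - 0) * realEnergy κ μ ρ + 0 * realEnergy κ ρ ρ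
      - w * (2 - 0))) :=
    (Continuous.tendsto (by fun_prop) 0).mono_left nhdsWithin_le_nhds
  have := ge_of_tendsto hl (Filter.mem_of_superset (Ioc_mem_nhdsGT one_pos)
    fun t ht => sub_nonneg.2 (hq t ht))
  linarith

omit [T2Space X] [BorelSpace X] in
lemma Concentrated.mono {A B : Set X} (hμ : Concentrated μ A) (h : A ⊆ B) : Concentrated μ B :=
  fun K hK => measure_mono_null (inter_subset_inter_left K (compl_subset_compl.2 h)) (hμ K hK)

omit [T2Space X] [BorelSpace X] in
lemma memBreve.mono {A B : Set X} (hμ : memBreve κ A μ) (h : A ⊆ B) : memBreve κ B μ :=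
  ⟨hμ.1, hμ.2.1.mono h, hμ.2.2⟩

lemma Concentrated.measure_compl_eq_zero [μ.Regular] [SigmaFinite μ] {A : Set X}
    (hμ : Concentrated μ A) : μ Aᶜ = 0 := by
  rw [← inter_univ Aᶜ, ← iUnion_spanningSets μ, inter_iUnion, measure_iUnion_null_iff]
  intro n
  refine le_antisymm (le_of_forall_pos_lt_add' fun ε hε => ?_) zero_le
  obtain ⟨K, -, hK, hlt⟩ := (measurableSet_spanningSets μ n).exists_isCompact_sdiff_lt
    (measure_spanningSets_lt_top μ n).ne hε.ne'
  calc μ (Aᶜ ∩ spanningSets μ n) ≤ μ ((Aᶜ ∩ K) ∪ (spanningSets μ n \ K)) :=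
        measure_mono fun x hx => by
          by_cases h : x ∈ K
          · exact Or.inl ⟨hx.1, h⟩
          · exact Or.inr ⟨hx.2, h⟩
    _ ≤ μ (Aᶜ ∩ K) + μ (spanningSets μ n \ K) := measure_union_le _ _
    _ < 0 + ε := by rwa [hμ K hK, zero_add, zero_add]

lemma memEplus.measure_compl_eq_zero (hker : IsKernel κ) (hE : EnergyPrinciple κ) {A : Set X}
    (hμ : memEplus κ μ) (hA : Concentrated μ A) : μ Aᶜ = 0 := by
  have : μ.Regular := hμ.1
  have := hμ.sigmaFinite hker.2 hE
  exact hA.measure_compl_eq_zero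

/-- The normalized restriction of a measure of finite energy to a compact set. -/
lemma memEplus.memBreve_normalized_restrict (hker : IsKernel κ) (hE : EnergyPrinciple κ)
    {A K : Set X} (hμ : memEplus κ μ) (hA : Concentrated μ A) (hK : IsCompact K) (h0 : μ K ≠ 0) :
    memBreve κ (A ∩ K) ((μ K)⁻¹ • μ.restrict K) := by
  have : μ.Regular := hμ.1
  have := hμ.sigmaFinite hker.2 hE
  have hE' : memEplus κ (μ.restrict K) :=
    ⟨Measure.Regular.restrict_of_measure_ne_top hK.measure_ne_top, lt_of_le_of_lt
      (lintegral_mono' (Measure.prod_mono Measure.restrict_le_self Measure.restrict_le_self)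
        le_rfl) hμ.2⟩
  refine ⟨hE'.smul hker hE (ENNReal.inv_ne_top.2 h0), Concentrated.smul (fun L hL => ?_) _, ?_⟩
  · rw [Measure.restrict_apply' hK.measurableSet]
    exact measure_mono_null (t := Aᶜ ∩ K)
      (fun x hx => ⟨fun h => hx.1.1 ⟨h, hx.2⟩, hx.2⟩) (hA K hK)
  · rw [Measure.smul_apply, Measure.restrict_apply_univ, smul_eq_mul,
      ENNReal.inv_mul_cancel h0 hK.measure_ne_top]

lemma memEplus.measure_eq_zero_of_forall_compact (hker : IsKernel κ) (hE : EnergyPrinciple κ)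
    {A S : Set X} (hμ : memEplus κ μ) (hA : Concentrated μ A) (hS : MeasurableSet S)
    (h : ∀ ρ, ∀ K ⊆ S, IsCompact K → memBreve κ (A ∩ K) ρ → False) : μ S = 0 := by
  have : μ.Regular := hμ.1
  have := hμ.sigmaFinite hker.2 hE
  by_contra h0
  obtain ⟨K, hKS, hK, hpos⟩ := hS.exists_lt_isCompact (pos_iff_ne_zero.2 h0)
  exact h _ K hKS hK (hμ.memBreve_normalized_restrict hker hE hA hK hpos.ne')

lemma NearlyEverywhere.ae (hker : IsKernel κ) (hE : EnergyPrinciple κ) {A : Set X} {P : X → Prop}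
    (h : NearlyEverywhere κ A P) (hP : MeasurableSet {x | ¬ P x}) (hμ : memEplus κ μ)
    (hA : Concentrated μ A) : ∀ᵐ x ∂μ, P x := by
  refine hμ.measure_eq_zero_of_forall_compact hker hE hA hP fun ρ K hKS hK hρ => ?_
  have h1 : wcap κ {x ∈ A | ¬ P x} = ⊤ := ENNReal.inv_eq_zero.1 h
  have h2 := iInf₂_le (f := fun μ (_ : memBreve κ {x ∈ A | ¬ P x} μ) => energy κ μ) ρ
    (hρ.mono fun x hx => ⟨hx.1, hKS hx.2⟩)
  exact hρ.1.2.not_ge (h1 ▸ h2)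

lemma nearlyEverywhere_of_forall_ae (hker : IsKernel κ) (hE : EnergyPrinciple κ) {A : Set X}
    {P : X → Prop} (h : ∀ ρ, memBreve κ A ρ → ∀ᵐ x ∂ρ, P x) : NearlyEverywhere κ A P := by
  by_contra hne
  have h1 : wcap κ {x ∈ A | ¬ P x} < ⊤ := lt_top_iff_ne_top.2 fun h => hne (ENNReal.inv_eq_zero.2 h)
  obtain ⟨ρ, hρ, -⟩ := exists_memBreve_energy_lt h1
  have h2 : ρ univ = 0 := measure_mono_null (t := {x | ¬ P x} ∪ {x ∈ A | ¬ P x}ᶜ)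
    (fun x _ => by by_cases hx : P x <;> simp [hx])
    (measure_union_null (h ρ (hρ.mono fun x hx => hx.1))
      (hρ.1.measure_compl_eq_zero hker hE hρ.2.1))
  exact one_ne_zero (hρ.2.2.symm.trans h2)

omit [T2Space X] in
lemma memEplus.measurable_potential (hker : IsKernel κ) (hμ : memEplus κ μ) :
    Measurable (potential κ μ) :=
  have : μ.Regular := hμ.1
  (lowerSemicontinuous_potential hker.2).measurable

lemma ae_le_potential (hker : IsKernel κ) (hE : EnergyPrinciple κ) {A : Set X} {c : ℝ≥0∞}
    (hμ : memEplus κ μ) (h : ∀ ρ, memBreve κ A ρ → c ≤ mutualEnergy κ ρ μ) (hν : memEplus κ ν)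
    (hA : Concentrated ν A) : ∀ᵐ x ∂ν, c ≤ potential κ μ x := by
  refine hν.measure_eq_zero_of_forall_compact hker hE hA
    (measurableSet_le measurable_const (hμ.measurable_potential hker)).compl fun ρ K hKS hK hρ => ?_
  have h1 := h ρ (hρ.mono inter_subset_left)
  rw [mutualEnergy_eq hker hE hρ.1 hμ] at h1
  have h0 : ρ ≠ 0 := by rintro rfl; exact zero_ne_one hρ.2.2
  have hae : ∀ᵐ x ∂ρ, potential κ μ x < c :=
    measure_mono_null (compl_subset_compl.2 fun x (hx : x ∈ A ∩ K) =>
      not_le.1 (show ¬ c ≤ potential κ μ x from hKS hx.2))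
      (hρ.1.measure_compl_eq_zero hker hE hρ.2.1)
  have h2 := lintegral_strict_mono h0 aemeasurable_const
    (mutualEnergy_eq hker hE hρ.1 hμ ▸ mutualEnergy_ne_top hE hρ.1 hμ) hae
  rw [lintegral_const, hρ.2.2, mul_one] at h2
  exact h2.not_ge h1

lemma ae_potential_le (hker : IsKernel κ) (hE : EnergyPrinciple κ) {A : Set X} {c : ℝ≥0∞}
    (hc : c ≠ ⊤) (hμ : memEplus κ μ) (h : ∀ ρ, memBreve κ A ρ → mutualEnergy κ ρ μ ≤ c)
    (hν : memEplus κ ν) (hA : Concentrated ν A) : ∀ᵐ x ∂ν, potential κ μ x ≤ c := by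
  refine hν.measure_eq_zero_of_forall_compact hker hE hA
    (measurableSet_le (hμ.measurable_potential hker) measurable_const).compl fun ρ K hKS hK hρ => ?_
  have h1 := h ρ (hρ.mono inter_subset_left)
  have h0 : ρ ≠ 0 := by rintro rfl; exact zero_ne_one hρ.2.2
  have hae : ∀ᵐ x ∂ρ, c < potential κ μ x :=
    measure_mono_null (compl_subset_compl.2 fun x (hx : x ∈ A ∩ K) =>
      not_le.1 (show ¬ potential κ μ x ≤ c from hKS hx.2))
      (hρ.1.measure_compl_eq_zero hker hE hρ.2.1)
  have hc' : ∫⁻ _, c ∂ρ = c := by rw [lintegral_const, hρ.2.2, mul_one]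
  have h2 := lintegral_strict_mono h0 (hμ.measurable_potential hker).aemeasurable
    (hc'.symm ▸ hc) hae
  rw [hc', ← mutualEnergy_eq hker hE hρ.1 hμ] at h2
  exact h2.not_ge h1

lemma tendsto_add_inv_succ (c : ℝ≥0∞) :
    Tendsto (fun n : ℕ => c + ((n : ℝ≥0∞) + 1)⁻¹) atTop (𝓝 c) := by
  have h := (ENNReal.tendsto_inv_nat_nhds_zero.comp (tendsto_add_atTop_nat 1)).const_add c
  simpa using h

omit [T2Space X] [BorelSpace X] in
lemma tendsto_realEnergy_of_energy_le {A : Set X} (hT : wcap κ A ≠ ⊤) {m : ℕ → Measure X}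
    (hm : ∀ n, memBreve κ A (m n)) {c : ℕ → ℝ≥0∞} (hc : Tendsto c atTop (𝓝 (wcap κ A)))
    (h : ∀ n, energy κ (m n) ≤ c n) :
    Tendsto (fun n => realEnergy κ (m n) (m n)) atTop (𝓝 (wcap κ A).toReal) :=
  (ENNReal.tendsto_toReal hT).comp
    (tendsto_of_tendsto_of_tendsto_of_le_of_le tendsto_const_nhds hc (fun n => iInf₂_le _ (hm n)) h)

lemma le_mutualEnergy (hker : IsKernel κ) (hE : EnergyPrinciple κ) (hμ : memEplus κ μ)
    (hρ : memEplus κ ρ) {c : ℝ≥0∞} (hc : c ≠ ⊤) (h : c.toReal ≤ realEnergy κ μ ρ) :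
    c ≤ mutualEnergy κ ρ μ := by
  rw [mutualEnergy_comm' hker hE hρ hμ]
  exact (ENNReal.toReal_le_toReal hc (mutualEnergy_ne_top hE hμ hρ)).1 h

lemma VagueTendstoSeq.memBreve [LocallyCompactSpace X] (hker : IsKernel κ)
    (hE : EnergyPrinciple κ) {K : Set X} (hK : IsCompact K) {m : ℕ → Measure X}
    (hm : ∀ n, memBreve κ K (m n)) (hμ : memEplus κ μ) (h : VagueTendstoSeq m μ) :
    memBreve κ K μ := by
  have hreg : μ.Regular := hμ.1
  have hmK : ∀ n, ∀ᵐ x ∂(m n), x ∈ K := fun n =>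
    (hm n).1.measure_compl_eq_zero hker hE (hm n).2.1
  have hK0 : ∀ᵐ x ∂μ, x ∈ K := by
    change μ Kᶜ = 0
    by_contra h0
    obtain ⟨L, hLK, hL, hpos⟩ := hK.isClosed.isOpen_compl.exists_lt_isCompact
      (pos_iff_ne_zero.2 h0)
    obtain ⟨φ, hφ1, hφ0, hφc, hφ⟩ := exists_continuous_one_zero_of_isCompact hL hK.isClosed
      (disjoint_left.2 hLK)
    have h1 := h φ φ.continuous hφc
    have h2 : ∀ n, ∫ x, φ x ∂(m n) = 0 := fun n =>
      integral_eq_zero_of_ae ((hmK n).mono fun x hx => hφ0 hx)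
    simp only [h2] at h1
    have h3 := (integral_eq_zero_iff_of_nonneg (fun x => (hφ x).1)
      (φ.continuous.integrable_of_hasCompactSupport hφc)).1
      (tendsto_nhds_unique h1 tendsto_const_nhds)
    refine hpos.ne' (measure_mono_null (fun x hx => ?_) h3)
    simp [hφ1 hx]
  refine ⟨hμ, fun L _ => measure_mono_null inter_subset_left hK0, ?_⟩
  obtain ⟨φ, hφ1, -, hφc, -⟩ := exists_continuous_one_zero_of_isCompact hK isClosed_empty
    (disjoint_empty K)
  have h1 : ∀ ρ : Measure X, (∀ᵐ x ∂ρ, x ∈ K) → ∫ x, φ x ∂ρ = ρ.real univ := fun ρ hρ => by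
    rw [integral_congr_ae (g := fun _ => (1 : ℝ)) (hρ.mono fun x hx => hφ1 hx)]
    simp
  have h2 := h φ φ.continuous hφc
  have h3 : ∀ n, ∫ x, φ x ∂(m n) = 1 := fun n => by simp [h1 _ (hmK n), Measure.real, (hm n).2.2]
  simp only [h3] at h2
  rw [h1 μ hK0] at h2
  have h4 := tendsto_nhds_unique tendsto_const_nhds h2
  rw [Measure.real, eq_comm, ENNReal.toReal_eq_one_iff] at h4
  exact h4

/-- The equilibrium measure of a compact set. -/
lemma exists_equilibrium_of_isCompact [LocallyCompactSpace X] (hker : IsKernel κ)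
    (hperf : IsPerfect κ) (hfr : FrostmanMax κ) {K : Set X} (hK : IsCompact K)
    (h0 : wcap κ K ≠ 0) (hT : wcap κ K ≠ ⊤) :
    ∃ μ, memBreve κ K μ ∧ energy κ μ = wcap κ K ∧ ∀ x, potential κ μ x ≤ wcap κ K := by
  have hE := hperf.1
  have hlt : ∀ n : ℕ, wcap κ K < wcap κ K + ((n : ℝ≥0∞) + 1)⁻¹ := fun n =>
    ENNReal.lt_add_right hT (by simp)
  choose m hm hmlt using fun n => exists_memBreve_energy_lt (hlt n)
  obtain ⟨μ, hμ, hconv, hen, hvar⟩ := exists_limit_of_minimizing hker hperf hm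
    (tendsto_realEnergy_of_energy_le hT hm (tendsto_add_inv_succ _) fun n => (hmlt n).le)
  have hμK := (hperf.2.2 m μ (fun n => (hm n).1) hμ hconv).memBreve hker hE hK hm hμ
  have hen' : energy κ μ = wcap κ K := (ENNReal.toReal_eq_toReal_iff' hμ.2.ne hT).1 hen
  have hge := ae_le_potential hker hE hμ
    (fun ρ hρ => le_mutualEnergy hker hE hμ hρ.1 hT (hvar ρ hρ)) hμ hμK.2.1
  have hint : ∫⁻ x, potential κ μ x ∂μ = ∫⁻ _, wcap κ K ∂μ := by
    rw [← mutualEnergy_eq hker hE hμ hμ, lintegral_const, hμK.2.2, mul_one]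
    exact hen'
  have heq := ae_eq_of_ae_le_of_lintegral_le hge
    (by rw [lintegral_const, hμK.2.2, mul_one]; exact hT)
    (hμ.measurable_potential hker).aemeasurable hint.le
  have hreg : μ.Regular := hμ.1
  refine ⟨μ, hμK, hen', fun x => ?_⟩
  have hpot : ∀ x, potential κ ((wcap κ K)⁻¹ • μ) x = (wcap κ K)⁻¹ * potential κ μ x :=
    fun x => lintegral_smul_measure _ _
  have key := hfr _ (hμ.smul hker hE (ENNReal.inv_ne_top.2 h0)) (fun y hy => ?_) x
  · rwa [hpot, ENNReal.inv_mul_le_iff h0 hT, mul_one] at key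
  · rw [hpot, ENNReal.inv_mul_le_iff h0 hT, mul_one]
    by_contra! hlt
    refine (hy _ ((lowerSemicontinuous_potential hker.2).isOpen_preimage (wcap κ K)) hlt).ne' ?_
    rw [Measure.smul_apply, smul_eq_mul, mul_eq_zero]
    exact Or.inr (measure_mono_null (t := {z | ¬ wcap κ K = potential κ μ z})
      (fun z (hz : wcap κ K < potential κ μ z) => hz.ne) heq)

omit [T2Space X] [BorelSpace X] in
lemma wcap_anti {A B : Set X} (h : A ⊆ B) : wcap κ B ≤ wcap κ A :=
  le_iInf₂ fun ρ hρ => iInf₂_le ρ (hρ.mono h)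

omit [T2Space X] [BorelSpace X] in
lemma energy_smul (hker : IsKernel κ) [SigmaFinite μ] {c : ℝ≥0∞} :
    energy κ (c • μ) = c * (c * energy κ μ) := by
  rw [energy, mutualEnergy_smul_left, mutualEnergy_comm hker.1, mutualEnergy_smul_left, energy]

/-- Inner capacity is approximated by compact subsets. -/
lemma exists_isCompact_wcap_lt (hker : IsKernel κ) (hE : EnergyPrinciple κ) {A : Set X}
    {c : ℝ≥0∞} (h : wcap κ A < c) : ∃ K ⊆ A, IsCompact K ∧ wcap κ K < c := by
  obtain ⟨μ, hμ, hlt⟩ := exists_memBreve_energy_lt h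
  have hreg : μ.Regular := hμ.1.1
  have hsf := hμ.1.sigmaFinite hker.2 hE
  have hlim : Tendsto (fun r : ℝ≥0∞ => r⁻¹ * (r⁻¹ * energy κ μ)) (𝓝[<] 1)
      (𝓝 (1⁻¹ * (1⁻¹ * energy κ μ))) := by
    have hinv : Tendsto (fun r : ℝ≥0∞ => r⁻¹) (𝓝[<] 1) (𝓝 1⁻¹) :=
      (continuous_inv.tendsto 1).mono_left nhdsWithin_le_nhds
    refine ENNReal.Tendsto.mul hinv (Or.inl (by simp)) (ENNReal.Tendsto.mul_const hinv
      (Or.inl (by simp))) (Or.inr (by simp))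
  rw [inv_one, one_mul, one_mul] at hlim
  have hne : (𝓝[<] (1 : ℝ≥0∞)).NeBot := nhdsLT_neBot_of_exists_lt ⟨0, one_pos⟩
  obtain ⟨r, hr, hr1⟩ := ((hlim.eventually_lt_const hlt).and self_mem_nhdsWithin).exists
  have hS : MeasurableSet (toMeasurable μ Aᶜ)ᶜ := (measurableSet_toMeasurable _ _).compl
  have hS1 : μ (toMeasurable μ Aᶜ)ᶜ = 1 := by
    have h0 : μ (toMeasurable μ Aᶜ) = 0 := by
      rw [measure_toMeasurable, hμ.1.measure_compl_eq_zero hker hE hμ.2.1]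
    rw [← hμ.2.2]
    exact measure_congr (eventuallyEq_univ.2 (by rwa [mem_ae_iff, compl_compl]))
  obtain ⟨K, hKS, hK, hrK⟩ := hS.exists_lt_isCompact (hr1.trans_eq hS1.symm)
  have hKA : K ⊆ A := hKS.trans (compl_subset_comm.1 (subset_toMeasurable μ Aᶜ))
  refine ⟨K, hKA, hK, ?_⟩
  have hρ := hμ.1.memBreve_normalized_restrict hker hE hμ.2.1 hK (zero_le.trans_lt hrK).ne'
  refine (iInf₂_le _ (hρ.mono inter_subset_right)).trans_lt (lt_of_le_of_lt ?_ hr)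
  have hr' := ENNReal.inv_le_inv.2 hrK.le
  rw [energy_smul hker]
  gcongr
  exact lintegral_mono' (Measure.prod_mono Measure.restrict_le_self Measure.restrict_le_self) le_rfl

/-- The inner equilibrium measure. -/
lemma exists_equilibrium [LocallyCompactSpace X] (hker : IsKernel κ) (hperf : IsPerfect κ)
    (hfr : FrostmanMax κ) {A : Set X} (hclosed : StrongClosedEplusOn κ A)
    (h0 : wcap κ A ≠ 0) (hT : wcap κ A ≠ ⊤) :
    ∃ μ, memBreve κ A μ ∧ (∀ ν, memEplus κ ν → mutualEnergy κ ν μ ≤ wcap κ A * ν univ) ∧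
      ∀ ν, memEplus κ ν → Concentrated ν A → ∀ᵐ x ∂ν, potential κ μ x = wcap κ A := by
  have hE := hperf.1
  have hlt : ∀ n : ℕ, wcap κ A < wcap κ A + ((n : ℝ≥0∞) + 1)⁻¹ := fun n =>
    ENNReal.lt_add_right hT (by simp)
  choose K hKA hK hKlt using fun n => exists_isCompact_wcap_lt hker hE (hlt n)
  choose m hmK hmen hmpot using fun n => exists_equilibrium_of_isCompact hker hperf hfr (hK n)
    ((pos_iff_ne_zero.2 h0).trans_le (wcap_anti (hKA n))).ne' (hKlt n).ne_top
  have hm : ∀ n, memBreve κ A (m n) := fun n => (hmK n).mono (hKA n)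
  obtain ⟨μ, hμ, hconv, hen, hvar⟩ := exists_limit_of_minimizing hker hperf hm
    (tendsto_realEnergy_of_energy_le hT hm (tendsto_add_inv_succ _)
      fun n => (hmen n).trans_le (hKlt n).le)
  have hμA : Concentrated μ A := hclosed m μ (fun n => ⟨(hm n).1, (hm n).2.1⟩) hμ hconv
  have hle : ∀ ν, memEplus κ ν → mutualEnergy κ ν μ ≤ wcap κ A * ν univ := fun ν hν => by
    rcases eq_or_ne (ν univ) ⊤ with h | h
    · rw [h, ENNReal.mul_top h0]
      exact le_top
    · have h1 : Tendsto (fun n => mutualEnergy κ (m n) ν) atTop (𝓝 (mutualEnergy κ μ ν)) :=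
        (ENNReal.tendsto_toReal_iff (fun n => mutualEnergy_ne_top hE (hm n).1 hν)
          (mutualEnergy_ne_top hE hμ hν)).1
          (tendsto_realEnergy hker hE (fun n => (hm n).1) hμ hconv hν)
      rw [mutualEnergy_comm' hker hE hν hμ]
      refine le_of_tendsto_of_tendsto' h1
        (ENNReal.Tendsto.mul_const (tendsto_add_inv_succ (wcap κ A)) (Or.inr h)) fun n => ?_
      rw [mutualEnergy_comm' hker hE (hm n).1 hν, mutualEnergy_eq hker hE hν (hm n).1,
        ← lintegral_const]
      exact lintegral_mono fun x => (hmpot n x).trans (hKlt n).le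
  have heq : ∀ ν, memEplus κ ν → Concentrated ν A → ∀ᵐ x ∂ν, potential κ μ x = wcap κ A :=
    fun ν hν hνA => by
      filter_upwards [ae_le_potential hker hE hμ (fun ρ hρ => le_mutualEnergy hker hE hμ hρ.1 hT
        (hvar ρ hρ)) hν hνA, ae_potential_le hker hE hT hμ (fun ρ hρ => by
          simpa [hρ.2.2] using hle ρ hρ.1) hν hνA] with x h1 h2
      exact le_antisymm h2 h1
  refine ⟨μ, ⟨hμ, hμA, ?_⟩, hle, heq⟩
  have h1 : wcap κ A * μ univ = wcap κ A * 1 := by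
    rw [← lintegral_const, ← lintegral_congr_ae (heq μ hμ hμA), ← mutualEnergy_eq hker hE hμ hμ,
      mul_one]
    exact (ENNReal.toReal_eq_toReal_iff' hμ.2.ne hT).1 hen
  exact (ENNReal.mul_right_inj h0 hT).1 h1

omit [TopologicalSpace X] [T2Space X] [BorelSpace X] in
lemma potential_add_smul (c : ℝ≥0∞) (x : X) :
    potential κ (μ + c • ν) x = potential κ μ x + c * potential κ ν x := by
  rw [potential, lintegral_add_measure, lintegral_smul_measure, smul_eq_mul]
  rfl

/-- A unit measure on `A` whose potential coincides on `A` with that of `ζ` up to a constant. -/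
lemma exists_memBreve_potential_eq [LocallyCompactSpace X] (hker : IsKernel κ)
    (hperf : IsPerfect κ) (hfr : FrostmanMax κ) {A : Set X} {ζ β : Measure X}
    (hcap0 : innerCap κ A ≠ 0) (hclosed : StrongClosedEplusOn κ A) (hζ : memEplus κ ζ)
    (hζ1 : ζ univ ≤ 1) (hβ : IsInnerBalayage κ A ζ β) (hex : innerCap κ A ≠ ⊤ ∨ β univ = 1) :
    ∃ ν, memBreve κ A ν ∧ ∀ ρ, memEplus κ ρ → Concentrated ρ A →
      ∀ᵐ x ∂ρ, potential κ ν x = (1 - β univ) / innerCap κ A + potential κ ζ x := by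
  have hE := hperf.1
  have hβζ : ∀ ρ, memEplus κ ρ → Concentrated ρ A →
      ∀ᵐ x ∂ρ, potential κ β x = potential κ ζ x := fun ρ hρ hρA =>
    hβ.2.2.ae hker hE (measurableSet_eq_fun (hβ.1.measurable_potential hker)
      (hζ.measurable_potential hker)).compl hρ hρA
  by_cases hβ1 : β univ = 1
  · refine ⟨β, ⟨hβ.1, hβ.2.1, hβ1⟩, fun ρ hρ hρA => ?_⟩
    simpa [hβ1] using hβζ ρ hρ hρA
  have h0 : wcap κ A ≠ 0 := fun h => hex.resolve_right hβ1 (by rw [innerCap, h, inv_zero])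
  have hT : wcap κ A ≠ ⊤ := fun h => hcap0 (by rw [innerCap, h, inv_top])
  obtain ⟨μ, hμ, hle, heq⟩ := exists_equilibrium hker hperf hfr hclosed h0 hT
  have hmass : β univ ≤ 1 := by
    refine (ENNReal.mul_le_mul_iff_right h0 hT).1 ?_
    calc wcap κ A * β univ = mutualEnergy κ β μ := by
          rw [mutualEnergy_eq hker hE hβ.1 hμ.1, lintegral_congr_ae (heq β hβ.1 hβ.2.1),
            lintegral_const]
      _ = mutualEnergy κ μ ζ := by
          rw [mutualEnergy_comm' hker hE hβ.1 hμ.1, mutualEnergy_eq hker hE hμ.1 hβ.1,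
            lintegral_congr_ae (hβζ μ hμ.1 hμ.2.1), mutualEnergy_eq hker hE hμ.1 hζ]
      _ ≤ wcap κ A * ζ univ := by
          rw [mutualEnergy_comm' hker hE hμ.1 hζ]
          exact hle ζ hζ
      _ ≤ wcap κ A * 1 := by gcongr
  have hc : 1 - β univ ≠ ⊤ := (tsub_le_self.trans_lt one_lt_top).ne
  refine ⟨β + (1 - β univ) • μ, ⟨hβ.1.add hker hE (hμ.1.smul hker hE hc),
    hβ.2.1.add (hμ.2.1.smul _), ?_⟩, fun ρ hρ hρA => ?_⟩
  · rw [Measure.add_apply, Measure.smul_apply, hμ.2.2, smul_eq_mul, mul_one,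
      add_tsub_cancel_of_le hmass]
  · filter_upwards [hβζ ρ hρ hρA, heq ρ hρ hρA] with x h1 h2
    rw [potential_add_smul, h1, h2, innerCap, div_eq_mul_inv, inv_inv, add_comm]

lemma memEplus.ae_potential_lt_top (hker : IsKernel κ) (hE : EnergyPrinciple κ)
    (hμ : memEplus κ μ) (hρ : memEplus κ ρ) : ∀ᵐ x ∂ρ, potential κ μ x < ⊤ :=
  ae_lt_top (hμ.measurable_potential hker)
    (mutualEnergy_eq hker hE hρ hμ ▸ mutualEnergy_ne_top hE hρ hμ)

lemma fieldIntegrable_neg_potential (hker : IsKernel κ) (hE : EnergyPrinciple κ)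
    (hμ : memEplus κ μ) (hρ : memEplus κ ρ) :
    FieldIntegrable (fun x => -(potential κ μ x : EReal)) ρ := by
  refine ⟨?_, (hμ.ae_potential_lt_top hker hE hρ).mono fun x hx => ?_⟩
  · simp only [EReal.toReal_neg_eq, EReal.toReal_coe_ennreal]
    exact (integrable_toReal_of_lintegral_ne_top (hμ.measurable_potential hker).aemeasurable
      (mutualEnergy_eq hker hE hρ hμ ▸ mutualEnergy_ne_top hE hρ hμ)).neg
  · simp [hx.ne]

lemma fieldIntegral_neg_potential (hker : IsKernel κ) (hE : EnergyPrinciple κ)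
    (hμ : memEplus κ μ) (hρ : memEplus κ ρ) :
    fieldIntegral (fun x => -(potential κ μ x : EReal)) ρ = -realEnergy κ ρ μ := by
  simp only [fieldIntegral, EReal.toReal_neg_eq, EReal.toReal_coe_ennreal, integral_neg]
  rw [integral_toReal (hμ.measurable_potential hker).aemeasurable
    (hμ.ae_potential_lt_top hker hE hρ), ← mutualEnergy_eq hker hE hρ hμ]
  rfl

omit [TopologicalSpace X] [T2Space X] [BorelSpace X] in
lemma coe_le_wPotential_iff {ζ : Measure X} {c : ℝ≥0∞} {x : X} :
    (c : EReal) ≤ wPotential κ (fun x => -(potential κ ζ x : EReal)) μ x ↔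
      potential κ ζ x ≠ ⊤ ∧ c + potential κ ζ x ≤ potential κ μ x := by
  rw [wPotential]
  by_cases h : potential κ ζ x = ⊤
  · simp [h]
  · rw [← sub_eq_add_neg, EReal.le_sub_iff_add_le (by simp) (by simp [h]),
      ← EReal.coe_ennreal_add, EReal.coe_ennreal_le_coe_ennreal_iff]
    exact (and_iff_right h).symm

end FiniteEnergy

theorem stmt5 {X : Type*} [TopologicalSpace X] [T2Space X] [LocallyCompactSpace X]
    [MeasurableSpace X] [BorelSpace X]
    (κ : X → X → ℝ≥0∞) (A : Set X) (ζ β : Measure X) (f : X → EReal)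
    (hker : IsKernel κ) (hperf : IsPerfect κ)
    (hfr : FrostmanMax κ) (hdom : DominationPrinciple κ)
    (hcap0 : innerCap κ A ≠ 0) (hclosed : StrongClosedEplusOn κ A)
    (hζ : memEplus κ ζ) (hζ1 : ζ Set.univ ≤ 1)
    (hf : ∀ x, f x = -((potential κ ζ x : ℝ≥0∞) : EReal))
    (hβ : IsInnerBalayage κ A ζ β)
    (hex : innerCap κ A ≠ ⊤ ∨ β Set.univ = 1)
    (l : Measure X) (hl : IsSolution κ A f l) :
    -- `l ∈ Λ_{A,f}`, with `η := (1 − ζ^A(X))/cap_*(A)`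
    (memEplus κ l ∧ NearlyEverywhere κ A
      (fun x => ((((1 : ℝ≥0∞) - β Set.univ) / innerCap κ A : ℝ≥0∞) : EReal)
        ≤ wPotential κ f l x)) ∧
    -- `l` is the unique measure of minimum energy in `Λ_{A,f}`
    ∀ μ : Measure X, memEplus κ μ →
      NearlyEverywhere κ A
        (fun x => ((((1 : ℝ≥0∞) - β Set.univ) / innerCap κ A : ℝ≥0∞) : EReal)
          ≤ wPotential κ f μ x) →
      energy κ l ≤ energy κ μ ∧ (energy κ l = energy κ μ → μ = l) := by
  obtain rfl : f = fun x => -(potential κ ζ x : EReal) := funext hf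
  have hE := hperf.1
  obtain ⟨ν, hν, hpot⟩ := exists_memBreve_potential_eq hker hperf hfr hcap0 hclosed hζ hζ1 hβ hex
  set η : ℝ≥0∞ := (1 - β univ) / innerCap κ A
  have hη : η ≠ ⊤ := ENNReal.div_ne_top (tsub_le_self.trans_lt one_lt_top).ne hcap0
  have henergy : ∀ ρ, memBreve κ A ρ → mutualEnergy κ ρ ν = η + mutualEnergy κ ρ ζ :=
    fun ρ hρ => by
      rw [mutualEnergy_eq hker hE hρ.1 hν.1, lintegral_congr_ae (hpot ρ hρ.1 hρ.2.1),
        lintegral_add_left measurable_const, lintegral_const, hρ.2.2, mul_one,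
        mutualEnergy_eq hker hE hρ.1 hζ]
  have hreal : ∀ ρ, memBreve κ A ρ → realEnergy κ ρ ν = η.toReal + realEnergy κ ρ ζ :=
    fun ρ hρ => by
      rw [realEnergy, henergy ρ hρ, ENNReal.toReal_add hη (mutualEnergy_ne_top hE hρ.1 hζ)]
      rfl
  have hgauss : ∀ ρ, memBreve κ A ρ → gaussI κ (fun x => -(potential κ ζ x : EReal)) ρ =
      realEnergy κ ρ ρ - 2 * realEnergy κ ρ ζ := fun ρ hρ => by
    rw [gaussI, fieldIntegral_neg_potential hker hE hζ hρ.1, mul_neg, ← sub_eq_add_neg]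
    rfl
  have hlν : l = ν := by
    have hle : gaussI κ (fun x => -(potential κ ζ x : EReal)) l ≤
        gaussI κ (fun x => -(potential κ ζ x : EReal)) ν := by
      rw [← EReal.coe_le_coe_iff, hl.2]
      exact iInf₂_le ν ⟨hν, fieldIntegrable_neg_potential hker hE hζ hν.1⟩
    refine eq_of_sqDist_nonpos hE hl.1.1.1 hν.1 ?_
    rw [hgauss l hl.1.1, hgauss ν hν] at hle
    rw [sqDist]
    linarith [hreal l hl.1.1, hreal ν hν]
  subst hlν
  simp only [coe_le_wPotential_iff]
  refine ⟨⟨hν.1, nearlyEverywhere_of_forall_ae hker hE fun ρ hρ => ?_⟩, fun μ hμ hμA => ?_⟩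
  · filter_upwards [hpot ρ hρ.1 hρ.2.1, hζ.ae_potential_lt_top hker hE hρ.1] with x h1 h2
    exact ⟨h2.ne, h1.ge⟩
  · have hmζ := hζ.measurable_potential hker
    have hae := hμA.ae hker hE ((hmζ (measurableSet_singleton ⊤)).compl.inter
      (measurableSet_le (hmζ.const_add η) (hμ.measurable_potential hker))).compl hν.1 hν.2.1
    have hle : energy κ l ≤ mutualEnergy κ μ l := by
      rw [mutualEnergy_comm' hker hE hμ hν.1, energy, mutualEnergy_eq hker hE hν.1 hν.1,
        mutualEnergy_eq hker hE hν.1 hμ]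
      refine lintegral_mono_ae ?_
      filter_upwards [hae, hpot l hν.1 hν.2.1] with x h1 h2
      exact h2.trans_le h1.2
    have hle' : realEnergy κ l l ≤ realEnergy κ μ l :=
      ENNReal.toReal_mono (mutualEnergy_ne_top hE hμ hν.1) hle
    have hd : sqDist κ μ l ≤ realEnergy κ μ μ - realEnergy κ l l := by
      rw [sqDist]
      linarith
    refine ⟨?_, fun heq => eq_of_sqDist_nonpos hE hμ hν.1 (hd.trans ?_)⟩
    · exact (ENNReal.toReal_le_toReal hν.1.2.ne hμ.2.ne).1
        (sub_nonneg.1 ((sqDist_nonneg hE hμ hν.1).trans hd))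
    · exact (sub_eq_zero.2 (congrArg ENNReal.toReal heq.symm)).le

end GaussVar
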